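/- There do not exist continuous functions q_1, q_2 : ℂ^2 → ℂ such that z·w = q_1(z,w)·z^2 + q_2(z,w)·w^2 for all (z,w) ∈ ℂ^2. (The monomial zw does not belong to the continuous closure of the ideal (z^2, w^2), although it belongs to its integral closure.) -/

import Mathlib

/-- A relation `zw = q₁ z² + q₂ w²` with continuous coefficients forces
`c = q₁(0) + q₂(0) c²` for every slope `c`, by restricting to the line `w = cz` and letting
`z` tend to `0`. -/
theorem slope_eq_of_mul_eq {q₁ q₂ : ℂ × ℂ → ℂ} (h₁ : Continuous q₁) (h₂ : Continuous q₂)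
    (h : ∀ z w : ℂ, z * w = q₁ (z, w) * z ^ 2 + q₂ (z, w) * w ^ 2) (c : ℂ) :
    c = q₁ (0, 0) + q₂ (0, 0) * c ^ 2 := by
  have hline : (fun _ : ℂ ↦ c) = fun t ↦ q₁ (t, c * t) + q₂ (t, c * t) * c ^ 2 := by
    refine Continuous.ext_on (dense_compl_singleton (0 : ℂ)) (by fun_prop) (by fun_prop) ?_
    intro t ht
    have ht' : t ^ 2 ≠ 0 := pow_ne_zero 2 ht
    apply mul_right_cancel₀ ht'
    linear_combination h t (c * t)
  simpa using congrFun hline 0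

/-- There are no continuous functions `q_1, q_2 : ℂ² → ℂ` with
`z·w = q_1(z,w)·z² + q_2(z,w)·w²` on all of `ℂ²`: the monomial `zw` does not belong to the
continuous closure of the ideal `(z², w²)`. -/
theorem stmt_16 :
    ¬ ∃ q₁ q₂ : ℂ × ℂ → ℂ, Continuous q₁ ∧ Continuous q₂ ∧
      ∀ z w : ℂ, z * w = q₁ (z, w) * z ^ 2 + q₂ (z, w) * w ^ 2 := by
  rintro ⟨q₁, q₂, h₁, h₂, h⟩
  have hpos := slope_eq_of_mul_eq h₁ h₂ h 1
  have hneg := slope_eq_of_mul_eq h₁ h₂ h (-1)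
  have hzero : (1 : ℂ) = 0 := by linear_combination (hpos - hneg) / 2
  exact one_ne_zero hzero
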